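/- Let ε, μ ∈ (0,1], b : ℝ² → ℝ smooth, and let ζ : ℝ × ℝ² → ℝ and v = (V₁,V₂) : ℝ × ℝ² → ℝ² be smooth with h = 1 + ε(ζ - b) > 0 everywhere, solving the new Green–Naghdi system: ∂ₜζ + ∇·(hv) = 0 and 𝔗∂ₜv + h∇ζ + ε𝔗((v·∇)v) + εμ{ (2/3)∇[h³(∂₁v·∂₂v⊥ + (∇·v)²)] + ℜ[h,εb](v) } = 0. Then w = curl v satisfies, pointwise, ∂ₜw + ε∇·(vw) = εμ f₁ + g, where f₁ = -curl( (1/h)(𝒯[h,εb] - ∇⊥curl)((v·∇)v) ) - curl( (1/h){ (2/3)∇[h³(∂₁v·∂₂v⊥ + (∇·v)²)] + ℜ[h,εb](v) } ) and g = -μ curl( (1/h)(𝒯[h,εb] - ∇⊥curl)(∂ₜv) ). -/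

import Mathlib

open MeasureTheory

noncomputable section

/-- Partial derivative in the first coordinate direction. -/
def pd1 (f : ℝ × ℝ → ℝ) (x : ℝ × ℝ) : ℝ := fderiv ℝ f x (1, 0)

/-- Partial derivative in the second coordinate direction. -/
def pd2 (f : ℝ × ℝ → ℝ) (x : ℝ × ℝ) : ℝ := fderiv ℝ f x (0, 1)

/-- Gradient of a scalar function on `ℝ²`. -/
def grad (f : ℝ × ℝ → ℝ) (x : ℝ × ℝ) : ℝ × ℝ := (pd1 f x, pd2 f x)

/-- Euclidean dot product on `ℝ²`. -/
def dot (a b : ℝ × ℝ) : ℝ := a.1 * b.1 + a.2 * b.2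

/-- Divergence of a vector field on `ℝ²`. -/
def divg (W : ℝ × ℝ → ℝ × ℝ) (x : ℝ × ℝ) : ℝ :=
  pd1 (fun y => (W y).1) x + pd2 (fun y => (W y).2) x

/-- Scalar curl of a vector field on `ℝ²`: `curl W = ∂₁W₂ - ∂₂W₁`. -/
def curl (W : ℝ × ℝ → ℝ × ℝ) (x : ℝ × ℝ) : ℝ :=
  pd1 (fun y => (W y).2) x - pd2 (fun y => (W y).1) x

/-- `∇⊥ f = (-∂₂ f, ∂₁ f)`. -/
def gradPerp (f : ℝ × ℝ → ℝ) (x : ℝ × ℝ) : ℝ × ℝ := (-(pd2 f x), pd1 f x)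

/-- The Green–Naghdi operator `𝒯[h, εb]`. -/
def Tcal (ε : ℝ) (h b : ℝ × ℝ → ℝ) (W : ℝ × ℝ → ℝ × ℝ) (x : ℝ × ℝ) : ℝ × ℝ :=
  (-(1/3 : ℝ)) • grad (fun y => (h y)^3 * divg W y) x
    + (ε/2) • (grad (fun y => (h y)^2 * dot (grad b y) (W y)) x
        - ((h x)^2 * divg W x) • grad b x)
    + (ε^2 * h x * dot (grad b x) (W x)) • grad b x

/-- The operator `𝔗 = h + μ(𝒯[h,εb] - ∇⊥ curl)`. -/
def Tfrak (ε μ : ℝ) (h b : ℝ × ℝ → ℝ) (W : ℝ × ℝ → ℝ × ℝ) (x : ℝ × ℝ) : ℝ × ℝ :=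
  h x • W x + μ • (Tcal ε h b W x - gradPerp (curl W) x)

/-- The advection term `(G·∇)w`, componentwise. -/
def advect (G w : ℝ × ℝ → ℝ × ℝ) (y : ℝ × ℝ) : ℝ × ℝ :=
  (dot (G y) (grad (fun z => (w z).1) y), dot (G y) (grad (fun z => (w z).2) y))

/-- `∂₁v·∂₂v⊥ + (∇·v)²`, with `∂₁v·∂₂v⊥ = -∂₁V₁∂₂V₂ + ∂₁V₂∂₂V₁`. -/
def Qterm (v : ℝ × ℝ → ℝ × ℝ) (y : ℝ × ℝ) : ℝ :=
  -(pd1 (fun z => (v z).1) y * pd2 (fun z => (v z).2) y)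
    + pd1 (fun z => (v z).2) y * pd2 (fun z => (v z).1) y
    + (divg v y)^2

/-- `V₁²∂₁²b + 2V₁V₂∂₁∂₂b + V₂²∂₂²b`. -/
def Bterm (b : ℝ × ℝ → ℝ) (v : ℝ × ℝ → ℝ × ℝ) (y : ℝ × ℝ) : ℝ :=
  (v y).1^2 * pd1 (pd1 b) y + 2 * (v y).1 * (v y).2 * pd1 (pd2 b) y
    + (v y).2^2 * pd2 (pd2 b) y

/-- The topographic term `ℜ[h,εb](v)`. -/
def Rfrak (ε : ℝ) (h b : ℝ × ℝ → ℝ) (v : ℝ × ℝ → ℝ × ℝ) (x : ℝ × ℝ) : ℝ × ℝ :=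
  (ε/2) • grad (fun y => (h y)^2 * Bterm b v y) x
    + (ε * (h x)^2 * Qterm v x) • grad b x
    + (ε^2 * h x * Bterm b v x) • grad b x

/-- The source term `f₁` of the vorticity equation. -/
def f1GN (ε : ℝ) (h b : ℝ × ℝ → ℝ) (v : ℝ × ℝ → ℝ × ℝ) (x : ℝ × ℝ) : ℝ :=
  -(curl (fun y => (1 / h y) •
      (Tcal ε h b (advect v v) y - gradPerp (curl (advect v v)) y)) x)
    - curl (fun y => (1 / h y) •
        ((2/3 : ℝ) • grad (fun z => (h z)^3 * Qterm v z) y + Rfrak ε h b v y)) x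

/-- The source term `g` of the vorticity equation, `vt` being `∂ₜv`. -/
def gGN (ε μ : ℝ) (h b : ℝ × ℝ → ℝ) (vt : ℝ × ℝ → ℝ × ℝ) (x : ℝ × ℝ) : ℝ :=
  -(μ * curl (fun y => (1 / h y) • (Tcal ε h b vt y - gradPerp (curl vt) y)) x)

/-- Directional derivatives of a smooth function commute. -/
theorem fderiv_fderiv_apply_comm {E : Type*} [NormedAddCommGroup E] [NormedSpace ℝ E]
    {F : E → ℝ} (hF : ContDiff ℝ (⊤ : ℕ∞) F) (p u w : E) :
    fderiv ℝ (fun q => fderiv ℝ F q u) p w = fderiv ℝ (fun q => fderiv ℝ F q w) p u := by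
  have hd : DifferentiableAt ℝ (fderiv ℝ F) p :=
    ((hF.fderiv_right (m := (⊤ : ℕ∞)) (by simp)).differentiable (by simp)) p
  have key : ∀ a c : E, fderiv ℝ (fun q => fderiv ℝ F q a) p c
      = fderiv ℝ (fderiv ℝ F) p c a := by
    intro a c
    rw [fderiv_clm_apply hd (differentiableAt_const a)]
    simp
  rw [key, key]
  exact (hF.contDiffAt.isSymmSndFDerivAt
    (by rw [minSmoothness_of_isRCLikeNormedField]; exact WithTop.coe_le_coe.2 le_top)) w u

/-- A slice in the space variables is differentiated by the full derivative. -/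
theorem fderiv_slice_right {F : ℝ × (ℝ × ℝ) → ℝ} (hF : ContDiff ℝ (⊤ : ℕ∞) F)
    (s : ℝ) (x e : ℝ × ℝ) :
    fderiv ℝ (fun y => F (s, y)) x e = fderiv ℝ F (s, x) (0, e) := by
  have h := ((hF.differentiable (by simp)) (s, x)).hasFDerivAt.comp x
    (hasFDerivAt_prodMk_right s x)
  have hcomp := h.fderiv
  simp only [Function.comp_def] at hcomp
  rw [hcomp]
  simp

/-- A slice in the time variable is differentiated by the full derivative. -/
theorem deriv_slice_left {F : ℝ × (ℝ × ℝ) → ℝ} (hF : ContDiff ℝ (⊤ : ℕ∞) F)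
    (t : ℝ) (x : ℝ × ℝ) :
    deriv (fun s => F (s, x)) t = fderiv ℝ F (t, x) (1, 0) := by
  have h := ((hF.differentiable (by simp)) (t, x)).hasFDerivAt.comp t
    (hasFDerivAt_prodMk_left (𝕜 := ℝ) t x)
  have hcomp := h.hasDerivAt.deriv
  simp only [Function.comp_def] at hcomp
  rw [hcomp]
  simp

theorem contDiff_fderiv_apply {E : Type*} [NormedAddCommGroup E] [NormedSpace ℝ E]
    {F : E → ℝ} (hF : ContDiff ℝ (⊤ : ℕ∞) F) (u : E) :
    ContDiff ℝ (⊤ : ℕ∞) (fun q => fderiv ℝ F q u) :=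
  (hF.fderiv_right (m := (⊤ : ℕ∞)) (by simp)).clm_apply contDiff_const

/-- Time and space derivatives commute. -/
theorem hasDerivAt_fderiv_slice {F : ℝ × (ℝ × ℝ) → ℝ} (hF : ContDiff ℝ (⊤ : ℕ∞) F)
    (t : ℝ) (x e : ℝ × ℝ) :
    HasDerivAt (fun s => fderiv ℝ (fun y => F (s, y)) x e)
      (fderiv ℝ (fun y => deriv (fun s => F (s, y)) t) x e) t := by
  have hG := contDiff_fderiv_apply hF ((0, e) : ℝ × (ℝ × ℝ))
  have hH := contDiff_fderiv_apply hF ((1, 0) : ℝ × (ℝ × ℝ))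
  simp only [fderiv_slice_right hF, deriv_slice_left hF]
  rw [fderiv_slice_right hH, fderiv_fderiv_apply_comm hF, ← deriv_slice_left hG]
  have hd : DifferentiableAt ℝ (fun s : ℝ => fderiv ℝ F (s, x) (0, e)) t :=
    ((hG.comp (contDiff_id.prodMk contDiff_const)).differentiable (by simp)) t
  exact hd.hasDerivAt

@[fun_prop]
theorem contDiff_pd1 {f : ℝ × ℝ → ℝ} (hf : ContDiff ℝ (⊤ : ℕ∞) f) :
    ContDiff ℝ (⊤ : ℕ∞) (pd1 f) :=
  contDiff_fderiv_apply hf _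

@[fun_prop]
theorem contDiff_pd2 {f : ℝ × ℝ → ℝ} (hf : ContDiff ℝ (⊤ : ℕ∞) f) :
    ContDiff ℝ (⊤ : ℕ∞) (pd2 f) :=
  contDiff_fderiv_apply hf _

@[fun_prop]
theorem contDiff_grad {f : ℝ × ℝ → ℝ} (hf : ContDiff ℝ (⊤ : ℕ∞) f) :
    ContDiff ℝ (⊤ : ℕ∞) (grad f) :=
  (contDiff_pd1 hf).prodMk (contDiff_pd2 hf)

@[fun_prop]
theorem contDiff_gradPerp {f : ℝ × ℝ → ℝ} (hf : ContDiff ℝ (⊤ : ℕ∞) f) :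
    ContDiff ℝ (⊤ : ℕ∞) (gradPerp f) :=
  (contDiff_pd2 hf).neg.prodMk (contDiff_pd1 hf)

@[fun_prop]
theorem contDiff_divg {W : ℝ × ℝ → ℝ × ℝ} (hW : ContDiff ℝ (⊤ : ℕ∞) W) :
    ContDiff ℝ (⊤ : ℕ∞) (divg W) :=
  (contDiff_pd1 hW.fst).add (contDiff_pd2 hW.snd)

@[fun_prop]
theorem contDiff_curl {W : ℝ × ℝ → ℝ × ℝ} (hW : ContDiff ℝ (⊤ : ℕ∞) W) :
    ContDiff ℝ (⊤ : ℕ∞) (curl W) :=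
  (contDiff_pd1 hW.snd).sub (contDiff_pd2 hW.fst)

@[fun_prop]
theorem contDiff_dot {A B : ℝ × ℝ → ℝ × ℝ} (hA : ContDiff ℝ (⊤ : ℕ∞) A)
    (hB : ContDiff ℝ (⊤ : ℕ∞) B) : ContDiff ℝ (⊤ : ℕ∞) (fun y => dot (A y) (B y)) :=
  (hA.fst.mul hB.fst).add (hA.snd.mul hB.snd)

@[fun_prop]
theorem contDiff_advect {G w : ℝ × ℝ → ℝ × ℝ} (hG : ContDiff ℝ (⊤ : ℕ∞) G)
    (hw : ContDiff ℝ (⊤ : ℕ∞) w) : ContDiff ℝ (⊤ : ℕ∞) (advect G w) :=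
  (contDiff_dot hG (contDiff_grad hw.fst)).prodMk (contDiff_dot hG (contDiff_grad hw.snd))

@[fun_prop]
theorem contDiff_Tcal (ε : ℝ) {h b : ℝ × ℝ → ℝ} {W : ℝ × ℝ → ℝ × ℝ}
    (hh : ContDiff ℝ (⊤ : ℕ∞) h) (hb : ContDiff ℝ (⊤ : ℕ∞) b)
    (hW : ContDiff ℝ (⊤ : ℕ∞) W) : ContDiff ℝ (⊤ : ℕ∞) (Tcal ε h b W) := by
  unfold Tcal
  fun_prop

@[fun_prop]
theorem contDiff_Qterm {v : ℝ × ℝ → ℝ × ℝ} (hv : ContDiff ℝ (⊤ : ℕ∞) v) :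
    ContDiff ℝ (⊤ : ℕ∞) (Qterm v) := by
  unfold Qterm
  fun_prop

@[fun_prop]
theorem contDiff_Bterm {b : ℝ × ℝ → ℝ} {v : ℝ × ℝ → ℝ × ℝ}
    (hb : ContDiff ℝ (⊤ : ℕ∞) b) (hv : ContDiff ℝ (⊤ : ℕ∞) v) :
    ContDiff ℝ (⊤ : ℕ∞) (Bterm b v) := by
  unfold Bterm
  fun_prop

@[fun_prop]
theorem contDiff_Rfrak (ε : ℝ) {h b : ℝ × ℝ → ℝ} {v : ℝ × ℝ → ℝ × ℝ}
    (hh : ContDiff ℝ (⊤ : ℕ∞) h) (hb : ContDiff ℝ (⊤ : ℕ∞) b)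
    (hv : ContDiff ℝ (⊤ : ℕ∞) v) : ContDiff ℝ (⊤ : ℕ∞) (Rfrak ε h b v) := by
  unfold Rfrak
  fun_prop

theorem curl_add {A B : ℝ × ℝ → ℝ × ℝ} (hA : ContDiff ℝ (⊤ : ℕ∞) A)
    (hB : ContDiff ℝ (⊤ : ℕ∞) B) (x : ℝ × ℝ) :
    curl (fun y => A y + B y) x = curl A x + curl B x := by
  have hA' := hA.differentiable (by simp)
  have hB' := hB.differentiable (by simp)
  simp only [curl, pd1, pd2, Prod.fst_add, Prod.snd_add]
  rw [fderiv_fun_add (by fun_prop) (by fun_prop), fderiv_fun_add (by fun_prop) (by fun_prop)]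
  simp only [_root_.add_apply]
  ring

theorem curl_const_smul {A : ℝ × ℝ → ℝ × ℝ} (hA : ContDiff ℝ (⊤ : ℕ∞) A) (c : ℝ)
    (x : ℝ × ℝ) : curl (fun y => c • A y) x = c * curl A x := by
  have hA' := hA.differentiable (by simp)
  simp only [curl, pd1, pd2, Prod.smul_fst, Prod.smul_snd]
  rw [fderiv_fun_const_smul (by fun_prop), fderiv_fun_const_smul (by fun_prop)]
  simp only [_root_.smul_apply, smul_eq_mul]
  ring

theorem curl_grad {f : ℝ × ℝ → ℝ} (hf : ContDiff ℝ (⊤ : ℕ∞) f) (x : ℝ × ℝ) :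
    curl (grad f) x = 0 :=
  sub_eq_zero.2 (fderiv_fderiv_apply_comm hf x (0, 1) (1, 0))

/-- `curl ((v·∇)v) = ∇·((curl v) v)`. -/
theorem curl_advect_self {v : ℝ × ℝ → ℝ × ℝ} (hv : ContDiff ℝ (⊤ : ℕ∞) v) (x : ℝ × ℝ) :
    curl (advect v v) x = divg (fun y => curl v y • v y) x := by
  have hV := hv.differentiable (by simp)
  have d1 : ∀ {f : ℝ × ℝ → ℝ}, ContDiff ℝ (⊤ : ℕ∞) f → Differentiable ℝ (pd1 f) :=
    fun hf => (contDiff_pd1 hf).differentiable (by simp)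
  have d2 : ∀ {f : ℝ × ℝ → ℝ}, ContDiff ℝ (⊤ : ℕ∞) f → Differentiable ℝ (pd2 f) :=
    fun hf => (contDiff_pd2 hf).differentiable (by simp)
  have a1 := d1 hv.fst
  have a2 := d2 hv.fst
  have b1 := d1 hv.snd
  have b2 := d2 hv.snd
  have hc : ∀ {f : ℝ × ℝ → ℝ}, ContDiff ℝ (⊤ : ℕ∞) f →
      fderiv ℝ (pd2 f) x (1, 0) = fderiv ℝ (pd1 f) x (0, 1) :=
    fun hf => fderiv_fderiv_apply_comm hf x (0, 1) (1, 0)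
  have s1 := hc hv.fst
  have s2 := hc hv.snd
  have mulApply : ∀ {f g : ℝ × ℝ → ℝ} (e : ℝ × ℝ), Differentiable ℝ f → Differentiable ℝ g →
      fderiv ℝ (fun y => f y * g y) x e = f x * fderiv ℝ g x e + g x * fderiv ℝ f x e := by
    intro f g e hf hg
    rw [fderiv_fun_mul (hf x) (hg x)]
    simp
  have addApply : ∀ {f g : ℝ × ℝ → ℝ} (e : ℝ × ℝ), Differentiable ℝ f → Differentiable ℝ g →
      fderiv ℝ (fun y => f y + g y) x e = fderiv ℝ f x e + fderiv ℝ g x e := by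
    intro f g e hf hg
    rw [fderiv_fun_add (hf x) (hg x)]
    simp
  have subApply : ∀ {f g : ℝ × ℝ → ℝ} (e : ℝ × ℝ), Differentiable ℝ f → Differentiable ℝ g →
      fderiv ℝ (fun y => f y - g y) x e = fderiv ℝ f x e - fderiv ℝ g x e := by
    intro f g e hf hg
    rw [fderiv_fun_sub (hf x) (hg x)]
    simp
  have f1 := hV.fst
  have f2 := hV.snd
  have e1 : curl (advect v v) x
      = fderiv ℝ (fun y => (v y).1 * pd1 (fun z => (v z).2) y
          + (v y).2 * pd2 (fun z => (v z).2) y) x (1, 0)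
        - fderiv ℝ (fun y => (v y).1 * pd1 (fun z => (v z).1) y
          + (v y).2 * pd2 (fun z => (v z).1) y) x (0, 1) := rfl
  have e2 : divg (fun y => curl v y • v y) x
      = fderiv ℝ (fun y => (pd1 (fun z => (v z).2) y - pd2 (fun z => (v z).1) y) * (v y).1)
          x (1, 0)
        + fderiv ℝ (fun y => (pd1 (fun z => (v z).2) y - pd2 (fun z => (v z).1) y) * (v y).2)
          x (0, 1) := rfl
  rw [e1, e2, addApply _ (f1.fun_mul b1) (f2.fun_mul b2), addApply _ (f1.fun_mul a1) (f2.fun_mul a2),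
    mulApply _ f1 b1, mulApply _ f2 b2, mulApply _ f1 a1, mulApply _ f2 a2,
    mulApply _ (b1.fun_sub a2) f1, mulApply _ (b1.fun_sub a2) f2,
    subApply _ b1 a2, subApply _ b1 a2, s1, s2]
  simp only [pd1, pd2]
  ring

/-- The curl commutes with the time derivative. -/
theorem deriv_curl {v : ℝ → ℝ × ℝ → ℝ × ℝ}
    (hv : ContDiff ℝ (⊤ : ℕ∞) (fun p : ℝ × (ℝ × ℝ) => v p.1 p.2)) (t : ℝ) (x : ℝ × ℝ) :
    deriv (fun s => curl (v s) x) t = curl (fun y => deriv (fun s => v s y) t) x := by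
  have hd : ∀ y, DifferentiableAt ℝ (fun s => v s y) t := fun y =>
    ((hv.comp (contDiff_id.prodMk contDiff_const)).differentiable (by simp)) t
  have c1 : ∀ y, (deriv (fun s => v s y) t).1 = deriv (fun s => (v s y).1) t := fun y =>
    (hasFDerivAt_fst.comp_hasDerivAt t (hd y).hasDerivAt).deriv.symm
  have c2 : ∀ y, (deriv (fun s => v s y) t).2 = deriv (fun s => (v s y).2) t := fun y =>
    (hasFDerivAt_snd.comp_hasDerivAt t (hd y).hasDerivAt).deriv.symm
  have h := (hasDerivAt_fderiv_slice hv.snd t x (1, 0)).sub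
    (hasDerivAt_fderiv_slice hv.fst t x (0, 1))
  simp only [curl, pd1, pd2, c1, c2]
  exact h.deriv

/-- The time derivative of a smooth field is smooth in space. -/
theorem contDiff_deriv_slice {v : ℝ → ℝ × ℝ → ℝ × ℝ}
    (hv : ContDiff ℝ (⊤ : ℕ∞) (fun p : ℝ × (ℝ × ℝ) => v p.1 p.2)) (t : ℝ) :
    ContDiff ℝ (⊤ : ℕ∞) (fun y => deriv (fun s => v s y) t) := by
  have hd : ∀ y, DifferentiableAt ℝ (fun s => v s y) t := fun y =>
    ((hv.comp (contDiff_id.prodMk contDiff_const)).differentiable (by simp)) t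
  have c : ∀ y, deriv (fun s => v s y) t
      = (fderiv ℝ (fun p : ℝ × (ℝ × ℝ) => (v p.1 p.2).1) (t, y) (1, 0),
        fderiv ℝ (fun p : ℝ × (ℝ × ℝ) => (v p.1 p.2).2) (t, y) (1, 0)) := by
    intro y
    refine Prod.ext ?_ ?_
    · exact (hasFDerivAt_fst.comp_hasDerivAt t (hd y).hasDerivAt).deriv.symm.trans (deriv_slice_left hv.fst t y)
    · exact (hasFDerivAt_snd.comp_hasDerivAt t (hd y).hasDerivAt).deriv.symm.trans (deriv_slice_left hv.snd t y)
  simp only [c]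
  have hs : ContDiff ℝ (⊤ : ℕ∞) (fun y : ℝ × ℝ => (t, y)) := contDiff_const.prodMk contDiff_id
  exact ((contDiff_fderiv_apply hv.fst _).comp hs).prodMk
    ((contDiff_fderiv_apply hv.snd _).comp hs)

/-- The vorticity equation `∂ₜw + ε∇·(vw) = εμf₁ + g` satisfied by `w = curl v` for
solutions of the new Green–Naghdi system (proof of Theorem 2). -/
theorem vorticity_equation (ε μ : ℝ) (hε : ε ∈ Set.Ioc (0:ℝ) 1)
    (hμ : μ ∈ Set.Ioc (0:ℝ) 1) (b : ℝ × ℝ → ℝ) (hb : ContDiff ℝ (⊤ : ℕ∞) b)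
    (ζ : ℝ → ℝ × ℝ → ℝ) (hζ : ContDiff ℝ (⊤ : ℕ∞) (fun p : ℝ × (ℝ × ℝ) => ζ p.1 p.2))
    (v : ℝ → ℝ × ℝ → ℝ × ℝ) (hv : ContDiff ℝ (⊤ : ℕ∞) (fun p : ℝ × (ℝ × ℝ) => v p.1 p.2))
    (hpos : ∀ t y, 0 < 1 + ε * (ζ t y - b y))
    (mass : ∀ t x, deriv (fun s => ζ s x) t
      + divg (fun y => (1 + ε * (ζ t y - b y)) • v t y) x = 0)
    (momentum : ∀ t x,
      Tfrak ε μ (fun y => 1 + ε * (ζ t y - b y)) b (fun y => deriv (fun s => v s y) t) x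
        + (1 + ε * (ζ t x - b x)) • grad (ζ t) x
        + ε • Tfrak ε μ (fun y => 1 + ε * (ζ t y - b y)) b (advect (v t) (v t)) x
        + (ε * μ) • ((2/3 : ℝ) • grad
              (fun y => (1 + ε * (ζ t y - b y))^3 * Qterm (v t) y) x
            + Rfrak ε (fun y => 1 + ε * (ζ t y - b y)) b (v t) x)
        = 0) :
    ∀ t x, deriv (fun s => curl (v s) x) t
        + ε * divg (fun y => curl (v t) y • v t y) x
      = ε * μ * f1GN ε (fun y => 1 + ε * (ζ t y - b y)) b (v t) x
        + gGN ε μ (fun y => 1 + ε * (ζ t y - b y)) b (fun y => deriv (fun s => v s y) t) x := by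
  intro t x
  set h : ℝ × ℝ → ℝ := fun y => 1 + ε * (ζ t y - b y) with hh_def
  set vt : ℝ × ℝ → ℝ × ℝ := fun y => deriv (fun s => v s y) t with hvt_def
  have hs : ContDiff ℝ (⊤ : ℕ∞) (fun y : ℝ × ℝ => (t, y)) := contDiff_const.prodMk contDiff_id
  have hζt : ContDiff ℝ (⊤ : ℕ∞) (ζ t) := hζ.comp hs
  have hV : ContDiff ℝ (⊤ : ℕ∞) (v t) := hv.comp hs
  have hvt : ContDiff ℝ (⊤ : ℕ∞) vt := contDiff_deriv_slice hv t
  have hh : ContDiff ℝ (⊤ : ℕ∞) h := by fun_prop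
  have hne : ∀ y, h y ≠ 0 := fun y => (hpos t y).ne'
  have hinv : ContDiff ℝ (⊤ : ℕ∞) (fun y => 1 / h y) := contDiff_const.div hh hne
  set A : ℝ × ℝ → ℝ × ℝ :=
    fun y => (1 / h y) • (Tcal ε h b vt y - gradPerp (curl vt) y) with hA_def
  set B : ℝ × ℝ → ℝ × ℝ := fun y => (1 / h y) •
    (Tcal ε h b (advect (v t) (v t)) y - gradPerp (curl (advect (v t) (v t))) y) with hB_def
  set C : ℝ × ℝ → ℝ × ℝ := fun y => (1 / h y) •
    ((2/3 : ℝ) • grad (fun z => (h z)^3 * Qterm (v t) z) y + Rfrak ε h b (v t) y) with hC_def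
  have hA : ContDiff ℝ (⊤ : ℕ∞) A := by fun_prop
  have hB : ContDiff ℝ (⊤ : ℕ∞) B := by fun_prop
  have hC : ContDiff ℝ (⊤ : ℕ∞) C := by fun_prop
  have hadv : ContDiff ℝ (⊤ : ℕ∞) (advect (v t) (v t)) := contDiff_advect hV hV
  have hg : ContDiff ℝ (⊤ : ℕ∞) (grad (ζ t)) := contDiff_grad hζt
  have hsum : (fun y => vt y + (grad (ζ t) y + (ε • advect (v t) (v t) y
      + (μ • A y + ((ε * μ) • B y + (ε * μ) • C y))))) = fun _ => (0 : ℝ × ℝ) := by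
    funext y
    have hm := congrArg (fun z => (1 / h y) • z) (momentum t y)
    have hh1 : 1 / h y * h y = 1 := by field_simp [hne y]
    have hfold : 1 + ε * (ζ t y - b y) = h y := rfl
    simp only [Tfrak, hfold, smul_zero, ← hvt_def, ← hh_def] at hm
    rw [← hm]
    simp only [hA_def, hB_def, hC_def]
    have e : ∀ a : ℝ × ℝ, a = (1 / h y) • (h y • a) := fun a => by rw [smul_smul, hh1, one_smul]
    conv_lhs => rw [e (vt y), e (grad (ζ t) y), e (advect (v t) (v t) y)]
    module
  have hcurl : curl (fun y => vt y + (grad (ζ t) y + (ε • advect (v t) (v t) y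
      + (μ • A y + ((ε * μ) • B y + (ε * μ) • C y))))) x = 0 := by
    rw [hsum]
    simp [curl, pd1, pd2]
  rw [curl_add hvt (by fun_prop), curl_add hg (by fun_prop),
    curl_add (hadv.const_smul ε) (by fun_prop), curl_add (hA.const_smul μ) (by fun_prop),
    curl_add (hB.const_smul _) (hC.const_smul _), curl_const_smul hadv, curl_const_smul hA,
    curl_const_smul hB, curl_const_smul hC, curl_grad hζt, curl_advect_self hV] at hcurl
  rw [deriv_curl hv]
  simp only [f1GN, gGN, ← hA_def, ← hB_def, ← hC_def, ← hvt_def]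
  linear_combination hcurl

end
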